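/- (Nonexistence of bore solutions.) Let γ be real, ε₁ > 0 and α > 0. Suppose η, ζ, ϑ : ℝ×[0,1] → ℝ are twice continuously differentiable on the closed strip and harmonic in R, satisfy on Γ: ζ(x,1) = 1 − γ/2 − (γ/2)η(x,1)², (ζ_y + γ η η_y)² + ε₁ ϑ_y² = (1 + ε₁ − 2α(η−1))·(η_x² + η_y²) at every point (x,1), and ϑ(x,1) = 1; satisfy η = ζ = ϑ = 0 on B; and satisfy inf over the closed strip of (1 + ε₁ − 2α(η−1))²·(η_x² + η_y²) > 0. Suppose further that there exist d₋ > 0 and d₊ > 0 such that, as x → −∞ (respectively x → +∞), the functions η, ζ, ϑ and their first-order partial derivatives converge uniformly in y ∈ [0,1] to the functions d·y, ((2−γ)/(2d) − γd/2)·d·y, y and their corresponding derivatives, with d = d₋ (respectively d = d₊). Then d₋ = d₊. -/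

import Mathlib

/-- The closed strip `ℝ × [0,1]`. -/
def strip : Set (ℝ × ℝ) := {p : ℝ × ℝ | p.2 ∈ Set.Icc (0 : ℝ) 1}

/-- The open strip `R = ℝ × (0,1)`. -/
def stripO : Set (ℝ × ℝ) := {p : ℝ × ℝ | p.2 ∈ Set.Ioo (0 : ℝ) 1}

/-- Partial derivative in the first (horizontal) variable, taken within the closed strip
(at interior points it agrees with the usual partial derivative; on the boundary it is
the one-sided partial derivative). -/
noncomputable def pdx (f : ℝ × ℝ → ℝ) (p : ℝ × ℝ) : ℝ := fderivWithin ℝ f strip p (1, 0)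

/-- Partial derivative in the second (vertical) variable, taken within the closed strip. -/
noncomputable def pdy (f : ℝ × ℝ → ℝ) (p : ℝ × ℝ) : ℝ := fderivWithin ℝ f strip p (0, 1)

section FlowForce

open Set Filter Topology Complex

theorem uniqueDiffOn_strip : UniqueDiffOn ℝ strip := by
  have h : strip = univ ×ˢ Icc (0 : ℝ) 1 := by ext; simp [strip]
  rw [h]
  exact uniqueDiffOn_univ.prod uniqueDiffOn_Icc_zero_one

theorem strip_mem_nhds {p : ℝ × ℝ} (hp : p ∈ stripO) : strip ∈ 𝓝 p :=
  mem_of_superset ((isOpen_Ioo.preimage continuous_snd).mem_nhds hp)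
    fun _ hq => Ioo_subset_Icc_self hq

theorem hasDerivAt_horizontal {f : ℝ × ℝ → ℝ} (hf : DifferentiableOn ℝ f strip) {y : ℝ}
    (hy : y ∈ Icc (0 : ℝ) 1) (x : ℝ) : HasDerivAt (fun t => f (t, y)) (pdx f (x, y)) x := by
  have h := (hf (x, y) hy).hasFDerivWithinAt
  exact h.comp_hasDerivAt x ((hasDerivAt_id x).prodMk (hasDerivAt_const x y))
    (Eventually.of_forall fun _ => hy)

/-- The function `f_y + i f_x` of `x + i y`, holomorphic when `f` is harmonic. -/
noncomputable def cgrad (f : ℝ × ℝ → ℝ) (z : ℂ) : ℂ :=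
  ⟨pdy f (z.re, z.im), pdx f (z.re, z.im)⟩

theorem cgrad_eq (f : ℝ × ℝ → ℝ) : cgrad f = fun z =>
    (pdy f (equivRealProdCLM z) : ℂ) + pdx f (equivRealProdCLM z) * I := by
  funext z
  apply Complex.ext <;> simp [cgrad]

theorem continuousOn_cgrad {f : ℝ × ℝ → ℝ} (hf : ContDiffOn ℝ 2 f strip) :
    ContinuousOn (cgrad f) {z | z.im ∈ Icc (0 : ℝ) 1} := by
  have h := hf.continuousOn_fderivWithin uniqueDiffOn_strip (by norm_num)
  have hE : ContinuousOn equivRealProdCLM {z : ℂ | z.im ∈ Icc (0 : ℝ) 1} :=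
    equivRealProdCLM.continuous.continuousOn
  have h' := h.comp hE (fun z hz => by simpa [strip] using hz)
  rw [cgrad_eq]
  have hx := h'.clm_apply (continuousOn_const (c := ((1, 0) : ℝ × ℝ)))
  have hy := h'.clm_apply (continuousOn_const (c := ((0, 1) : ℝ × ℝ)))
  exact (continuous_ofReal.comp_continuousOn hy).add
    ((continuous_ofReal.comp_continuousOn hx).mul continuousOn_const)

theorem differentiableAt_cgrad {f : ℝ × ℝ → ℝ} (hf : ContDiffOn ℝ 2 f strip)
    (hH : ∀ p ∈ stripO, pdx (pdx f) p + pdy (pdy f) p = 0) {z : ℂ}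
    (hz : z.im ∈ Ioo (0 : ℝ) 1) : DifferentiableAt ℂ (cgrad f) z := by
  set p : ℝ × ℝ := equivRealProdCLM z with hp
  have hpO : p ∈ stripO := by simpa [stripO, hp] using hz
  have hc : ContDiffAt ℝ 2 f p := hf.contDiffAt (strip_mem_nhds hpO)
  have hdf : DifferentiableAt ℝ (fderiv ℝ f) p :=
    (hc.fderiv_right (m := 1) (by norm_num)).differentiableAt (by norm_num)
  have hev : fderivWithin ℝ f strip =ᶠ[𝓝 p] fderiv ℝ f := by
    filter_upwards [(isOpen_Ioo.preimage continuous_snd).mem_nhds hpO] with q hq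
    exact fderivWithin_of_mem_nhds (strip_mem_nhds hq)
  have hdw : HasFDerivAt (fderivWithin ℝ f strip) (fderiv ℝ (fderiv ℝ f) p) p :=
    hdf.hasFDerivAt.congr_of_eventuallyEq hev
  set D := fderiv ℝ (fderiv ℝ f) p with hD
  have hx : HasFDerivAt (pdx f) (D.flip (1, 0)) p := by
    have h := hdw.clm_apply (hasFDerivAt_const ((1, 0) : ℝ × ℝ) p)
    simp only [ContinuousLinearMap.comp_zero, zero_add] at h
    exact h
  have hy : HasFDerivAt (pdy f) (D.flip (0, 1)) p := by
    have h := hdw.clm_apply (hasFDerivAt_const ((0, 1) : ℝ × ℝ) p)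
    simp only [ContinuousLinearMap.comp_zero, zero_add] at h
    exact h
  have hsymm : D (1, 0) (0, 1) = D (0, 1) (1, 0) := hc.isSymmSndFDerivAt (by simp) _ _
  have hlap : D (1, 0) (1, 0) + D (0, 1) (0, 1) = 0 := by
    have h := hH p hpO
    have e1 : pdx (pdx f) p = D (1, 0) (1, 0) := by
      rw [pdx, fderivWithin_of_mem_nhds (strip_mem_nhds hpO), hx.fderiv]; rfl
    have e2 : pdy (pdy f) p = D (0, 1) (0, 1) := by
      rw [pdy, fderivWithin_of_mem_nhds (strip_mem_nhds hpO), hy.fderiv]; rfl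
    rwa [e1, e2] at h
  have hE : HasFDerivAt (fun z : ℂ => equivRealProdCLM z)
    (equivRealProdCLM : ℂ →L[ℝ] ℝ × ℝ) z := equivRealProdCLM.hasFDerivAt
  have hx' := ofRealCLM.hasFDerivAt.comp z (hx.comp z hE)
  have hy' := ofRealCLM.hasFDerivAt.comp z (hy.comp z hE)
  have hF := hy'.add (hx'.mul_const I)
  rw [cgrad_eq]
  refine differentiableAt_complex_iff_differentiableAt_real.2 ⟨hF.differentiableAt, ?_⟩
  have hval : fderiv ℝ (fun z => (pdy f (equivRealProdCLM z) : ℂ)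
      + pdx f (equivRealProdCLM z) * I) z = _ := hF.fderiv
  rw [hval]
  have h2 : D (0, 1) (0, 1) = - D (1, 0) (1, 0) := by linarith
  apply Complex.ext <;> simp [hsymm, h2]

/-- Cauchy's theorem on rectangles of full height in the strip, when the imaginary part is
zero on the bottom and minus the derivative of `P` on the top. -/
theorem integral_re_add_eq {g : ℂ → ℂ} {P : ℝ → ℝ}
    (hgc : ContinuousOn g {z | z.im ∈ Icc (0 : ℝ) 1})
    (hgd : ∀ z : ℂ, z.im ∈ Ioo (0 : ℝ) 1 → DifferentiableAt ℂ g z)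
    (hbot : ∀ x : ℝ, (g ⟨x, 0⟩).im = 0)
    (htop : ∀ x : ℝ, HasDerivAt P (-(g ⟨x, 1⟩).im) x) (a b : ℝ) :
    (∫ y in (0 : ℝ)..1, (g ⟨a, y⟩).re) + P a = (∫ y in (0 : ℝ)..1, (g ⟨b, y⟩).re) + P b := by
  have hC := integral_boundary_rect_eq_zero_of_continuousOn_of_differentiableOn g ⟨a, 0⟩ ⟨b, 1⟩
    (hgc.mono fun z hz => by simpa [mem_reProdIm] using hz.2)
    (fun z hz => (hgd z (by simpa using hz.2)).differentiableWithinAt)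
  have hmk : ∀ x y : ℝ, (x : ℂ) + y * I = ⟨x, y⟩ := fun x y => (mk_eq_add_mul_I x y).symm
  simp only [hmk] at hC
  have hh : ∀ y ∈ Icc (0 : ℝ) 1, Continuous fun x : ℝ => g ⟨x, y⟩ := fun y hy =>
    hgc.comp_continuous (by simp only [← hmk]; fun_prop) fun _ => hy
  have hv : ∀ x : ℝ, ContinuousOn (fun y : ℝ => g ⟨x, y⟩) (uIcc 0 1) := fun x =>
    hgc.comp (f := fun y : ℝ => (⟨x, y⟩ : ℂ)) (by simp only [← hmk]; fun_prop)
      fun y hy => by simpa using hy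
  have him : ∀ y ∈ Icc (0 : ℝ) 1, (∫ x in a..b, g ⟨x, y⟩).im = ∫ x in a..b, (g ⟨x, y⟩).im :=
    fun y hy => (imCLM.intervalIntegral_comp_comm ((hh y hy).intervalIntegrable a b)).symm
  have hre : ∀ x : ℝ, (∫ y in (0 : ℝ)..1, g ⟨x, y⟩).re = ∫ y in (0 : ℝ)..1, (g ⟨x, y⟩).re :=
    fun x => (reCLM.intervalIntegral_comp_comm (hv x).intervalIntegrable).symm
  have hP : ∫ x in a..b, -(g ⟨x, 1⟩).im = P b - P a :=
    intervalIntegral.integral_eq_sub_of_hasDerivAt (fun x _ => htop x)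
      ((continuous_im.comp (hh 1 (by simp))).neg.intervalIntegrable a b)
  have hI := congrArg Complex.im hC
  simp [him, hre, hbot] at hI
  rw [intervalIntegral.integral_neg] at hP
  linarith

theorem tendsto_integral_of_tendsto_prod_principal {l : Filter ℝ} {g : ℝ × ℝ → ℝ} {c : ℝ}
    (h : Tendsto g (l ×ˢ 𝓟 (Icc (0 : ℝ) 1)) (𝓝 c))
    (hg : ∀ x : ℝ, ContinuousOn (fun y => g (x, y)) (Icc (0 : ℝ) 1)) :
    Tendsto (fun x => ∫ y in (0 : ℝ)..1, g (x, y)) l (𝓝 c) := by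
  rw [Metric.tendsto_nhds]
  intro ε hε
  have h1 := Metric.tendsto_nhds.1 h (ε / 2) (half_pos hε)
  rw [eventually_prod_principal_iff] at h1
  filter_upwards [h1] with x hx
  have hi : IntervalIntegrable (fun y => g (x, y)) MeasureTheory.volume 0 1 :=
    ContinuousOn.intervalIntegrable (by simpa using hg x)
  have h2 : ∫ y in (0 : ℝ)..1, (g (x, y) - c) = (∫ y in (0 : ℝ)..1, g (x, y)) - c := by
    rw [intervalIntegral.integral_sub hi intervalIntegrable_const]; simp
  have h3 := intervalIntegral.norm_integral_le_of_norm_le_const (a := 0) (b := 1)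
    (f := fun y => g (x, y) - c) (C := ε / 2) (fun y hy => by
      rw [uIoc_of_le zero_le_one] at hy
      exact (hx y (Ioc_subset_Icc_self hy)).le)
  rw [h2] at h3
  rw [Real.dist_eq, ← Real.norm_eq_abs]
  simp at h3 ⊢
  linarith

theorem tendsto_cgrad {f : ℝ × ℝ → ℝ} (hf : DifferentiableOn ℝ f strip) {l : Filter ℝ} {m : ℝ}
    (h : ∀ ε > (0 : ℝ), ∀ᶠ x in l, ∀ y ∈ Icc (0 : ℝ) 1,
      ‖iteratedFDerivWithin ℝ 1 (fun q : ℝ × ℝ => f q - m * q.2) strip (x, y)‖ < ε) :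
    Tendsto (fun p : ℝ × ℝ => cgrad f ⟨p.1, p.2⟩) (l ×ˢ 𝓟 (Icc (0 : ℝ) 1)) (𝓝 (m : ℂ)) := by
  rw [Metric.tendsto_nhds]
  intro ε hε
  rw [eventually_prod_principal_iff]
  filter_upwards [h (ε / 2) (half_pos hε)] with x hx y hy
  have hxy := hx y hy
  have hp : (x, y) ∈ strip := hy
  have hu := uniqueDiffOn_strip _ hp
  have hm : HasFDerivWithinAt (fun q : ℝ × ℝ => m * q.2)
      (m • ContinuousLinearMap.snd ℝ ℝ ℝ) strip (x, y) :=
    (hasFDerivWithinAt_snd).const_mul m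
  rw [norm_iteratedFDerivWithin_one _ hu,
    ((hf _ hp).hasFDerivWithinAt.fun_sub hm).fderivWithin hu] at hxy
  have h1 := (ContinuousLinearMap.le_opNorm (fderivWithin ℝ f strip (x, y) -
    m • ContinuousLinearMap.snd ℝ ℝ ℝ) ((1, 0) : ℝ × ℝ)).trans_lt (by simpa using hxy)
  have h2 := (ContinuousLinearMap.le_opNorm (fderivWithin ℝ f strip (x, y) -
    m • ContinuousLinearMap.snd ℝ ℝ ℝ) ((0, 1) : ℝ × ℝ)).trans_lt (by simpa using hxy)
  simp at h1 h2
  rw [dist_eq_norm]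
  refine (norm_le_abs_re_add_abs_im _).trans_lt ?_
  simp [cgrad, pdx, pdy]
  linarith

/-- The part of the flow force that depends only on the height `h` of the surface. -/
noncomputable def surfaceForce (γ ε₁ α h : ℝ) : ℝ :=
  ((1 + ε₁) / 2 + α) * h - α / 2 * h ^ 2 - γ ^ 2 / 6 * h ^ 3

/-- The flow force of a laminar flow of depth `d`. -/
noncomputable def laminarFlowForce (γ ε₁ α d : ℝ) : ℝ :=
  ((1 - γ / 2 - γ / 2 * d ^ 2) ^ 2 + ε₁) / (2 * d) + surfaceForce γ ε₁ α d

theorem depth_eq_of_laminarFlowForce_eq {γ ε₁ α d e : ℝ} (hε₁ : 0 < ε₁) (hd : 0 < d) (he : 0 < e)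
    (hBd : (1 - γ / 2 + γ / 2 * d ^ 2) ^ 2 + ε₁ = (1 + ε₁ - 2 * α * (d - 1)) * d ^ 2)
    (hBe : (1 - γ / 2 + γ / 2 * e ^ 2) ^ 2 + ε₁ = (1 + ε₁ - 2 * α * (e - 1)) * e ^ 2)
    (hS : laminarFlowForce γ ε₁ α d = laminarFlowForce γ ε₁ α e) : d = e := by
  have hK : 0 < (1 - γ / 2) ^ 2 + ε₁ := by positivity
  have key : (e - d) ^ 3 * (((1 - γ / 2) ^ 2 + ε₁) / (2 * d ^ 2 * e ^ 2) + γ ^ 2 / 24) = 0 := by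
    have h1 : ((1 - γ / 2 + γ / 2 * d ^ 2) ^ 2 + ε₁) / d ^ 2 = 1 + ε₁ - 2 * α * (d - 1) := by
      rw [hBd]; field_simp
    have h2 : ((1 - γ / 2 + γ / 2 * e ^ 2) ^ 2 + ε₁) / e ^ 2 = 1 + ε₁ - 2 * α * (e - 1) := by
      rw [hBe]; field_simp
    have h3 : (e - d) ^ 3 * (((1 - γ / 2) ^ 2 + ε₁) / (2 * d ^ 2 * e ^ 2) + γ ^ 2 / 24)
        = 2 * (laminarFlowForce γ ε₁ α e - laminarFlowForce γ ε₁ α d)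
          - (e - d) / 2 * ((1 + ε₁ - 2 * α * (d - 1)
              - ((1 - γ / 2 + γ / 2 * d ^ 2) ^ 2 + ε₁) / d ^ 2)
            + (1 + ε₁ - 2 * α * (e - 1)
              - ((1 - γ / 2 + γ / 2 * e ^ 2) ^ 2 + ε₁) / e ^ 2)) := by
      unfold laminarFlowForce surfaceForce
      field_simp
      ring
    rw [h3, h1, h2, hS]
    ring
  rcases mul_eq_zero.1 key with h | h
  · have := pow_eq_zero_iff (three_ne_zero) |>.1 h
    linarith
  · have : 0 < ((1 - γ / 2) ^ 2 + ε₁) / (2 * d ^ 2 * e ^ 2) + γ ^ 2 / 24 := by positivity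
    linarith

/-- The density of the flow force in conformal variables. -/
noncomputable def forceDensity (ε₁ : ℝ) (η ζ ϑ : ℝ × ℝ → ℝ) (z : ℂ) : ℂ :=
  ((cgrad ζ z) ^ 2 + ε₁ * (cgrad ϑ z) ^ 2) / (2 * cgrad η z)

theorem hasDerivAt_surfaceForce (γ ε₁ α h : ℝ) : HasDerivAt (surfaceForce γ ε₁ α)
    ((1 + ε₁) / 2 + α - α * h - γ ^ 2 / 2 * h ^ 2) h := by
  have h1 := (((hasDerivAt_id h).const_mul ((1 + ε₁) / 2 + α)).fun_sub
    ((hasDerivAt_pow 2 h).const_mul (α / 2))).fun_sub ((hasDerivAt_pow 3 h).const_mul (γ ^ 2 / 6))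
  refine h1.congr_deriv ?_
  norm_num
  ring

theorem im_sq_div_eq (a b c d : ℝ) :
    (((⟨a, b⟩ : ℂ) ^ 2) / (2 * (⟨c, d⟩ : ℂ))).im
      = (2 * a * b * c - (a ^ 2 - b ^ 2) * d) / (2 * (d ^ 2 + c ^ 2)) := by
  have h2 : (2 : ℂ) * ⟨c, d⟩ = ⟨2 * c, 2 * d⟩ := by apply Complex.ext <;> simp
  rw [h2, div_im, normSq_mk]
  simp only [sq, mul_re, mul_im]
  by_cases h : d * d + c * c = 0
  · have h' : 2 * c * (2 * c) + 2 * d * (2 * d) = 0 := by linarith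
    simp [h, h']
  · have h' : 2 * c * (2 * c) + 2 * d * (2 * d) ≠ 0 := fun h0 => h (by linarith)
    field_simp
    ring

theorem im_forceDensity (ε₁ : ℝ) (η ζ ϑ : ℝ × ℝ → ℝ) (x y : ℝ) :
    (forceDensity ε₁ η ζ ϑ ⟨x, y⟩).im =
      ((2 * pdy ζ (x, y) * pdx ζ (x, y) * pdy η (x, y)
          - (pdy ζ (x, y) ^ 2 - pdx ζ (x, y) ^ 2) * pdx η (x, y))
        + ε₁ * (2 * pdy ϑ (x, y) * pdx ϑ (x, y) * pdy η (x, y)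
          - (pdy ϑ (x, y) ^ 2 - pdx ϑ (x, y) ^ 2) * pdx η (x, y)))
        / (2 * (pdx η (x, y) ^ 2 + pdy η (x, y) ^ 2)) := by
  rw [forceDensity, add_div, mul_div_assoc, add_im, im_ofReal_mul]
  simp only [cgrad, im_sq_div_eq]
  ring

theorem flowForce_eq {γ ε₁ α : ℝ} {η ζ ϑ : ℝ × ℝ → ℝ}
    (hηC : ContDiffOn ℝ 2 η strip) (hζC : ContDiffOn ℝ 2 ζ strip)
    (hϑC : ContDiffOn ℝ 2 ϑ strip)
    (hηH : ∀ p ∈ stripO, pdx (pdx η) p + pdy (pdy η) p = 0)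
    (hζH : ∀ p ∈ stripO, pdx (pdx ζ) p + pdy (pdy ζ) p = 0)
    (hϑH : ∀ p ∈ stripO, pdx (pdx ϑ) p + pdy (pdy ϑ) p = 0)
    (hΓ1 : ∀ x : ℝ, ζ (x, 1) = 1 - γ / 2 - (γ / 2) * (η (x, 1)) ^ 2)
    (hΓ2 : ∀ x : ℝ,
      (pdy ζ (x, 1) + γ * η (x, 1) * pdy η (x, 1)) ^ 2 + ε₁ * (pdy ϑ (x, 1)) ^ 2
        = (1 + ε₁ - 2 * α * (η (x, 1) - 1))
            * ((pdx η (x, 1)) ^ 2 + (pdy η (x, 1)) ^ 2))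
    (hΓ3 : ∀ x : ℝ, ϑ (x, 1) = 1)
    (hB : ∀ x : ℝ, η (x, 0) = 0 ∧ ζ (x, 0) = 0 ∧ ϑ (x, 0) = 0)
    (hne : ∀ p ∈ strip, pdx η p ^ 2 + pdy η p ^ 2 ≠ 0) :
    (∀ x : ℝ, ContinuousOn (fun y : ℝ => (forceDensity ε₁ η ζ ϑ ⟨x, y⟩).re) (Icc 0 1)) ∧
    ∀ a b : ℝ,
      (∫ y in (0 : ℝ)..1, (forceDensity ε₁ η ζ ϑ ⟨a, y⟩).re) + surfaceForce γ ε₁ α (η (a, 1))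
      = (∫ y in (0 : ℝ)..1, (forceDensity ε₁ η ζ ϑ ⟨b, y⟩).re)
        + surfaceForce γ ε₁ α (η (b, 1)) := by
  have hne' : ∀ z : ℂ, z.im ∈ Icc (0 : ℝ) 1 → 2 * cgrad η z ≠ 0 := by
    intro z hz h0
    have h1 : cgrad η z = 0 := by simpa using h0
    have hre := congrArg Complex.re h1
    have him := congrArg Complex.im h1
    simp only [cgrad, zero_re, zero_im] at hre him
    exact hne (z.re, z.im) hz (by rw [hre, him]; ring)
  have hgc : ContinuousOn (forceDensity ε₁ η ζ ϑ) {z | z.im ∈ Icc (0 : ℝ) 1} :=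
    (((continuousOn_cgrad hζC).pow 2).add
      (continuousOn_const.mul ((continuousOn_cgrad hϑC).pow 2))).div
      (continuousOn_const.mul (continuousOn_cgrad hηC)) hne'
  have hd : ∀ {f : ℝ × ℝ → ℝ}, ContDiffOn ℝ 2 f strip → ∀ {y : ℝ}, y ∈ Icc (0 : ℝ) 1 → ∀ x,
      HasDerivAt (fun t => f (t, y)) (pdx f (x, y)) x := fun hf _ hy x =>
    hasDerivAt_horizontal (hf.differentiableOn (by norm_num)) hy x
  have h0 : (0 : ℝ) ∈ Icc (0 : ℝ) 1 := by simp
  have h1 : (1 : ℝ) ∈ Icc (0 : ℝ) 1 := by simp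
  have hconst : ∀ {f : ℝ × ℝ → ℝ} {y c : ℝ}, ContDiffOn ℝ 2 f strip → y ∈ Icc (0 : ℝ) 1 →
      (∀ x, f (x, y) = c) → ∀ x, pdx f (x, y) = 0 := by
    intro f y c hf hy hc x
    have h := hd hf hy x
    simp only [hc] at h
    exact h.unique (hasDerivAt_const x c)
  refine ⟨fun x => ?_, integral_re_add_eq (P := fun x => surfaceForce γ ε₁ α (η (x, 1))) hgc
    (fun z hz => ?_) (fun x => ?_) (fun x => ?_)⟩
  · refine continuous_re.comp_continuousOn
      (hgc.comp (f := fun y : ℝ => (⟨x, y⟩ : ℂ)) ?_ fun y hy => hy)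
    simp only [mk_eq_add_mul_I]
    fun_prop
  · exact (((differentiableAt_cgrad hζC hζH hz).pow 2).add
      ((differentiableAt_const _).mul ((differentiableAt_cgrad hϑC hϑH hz).pow 2))).div
      ((differentiableAt_const _).mul (differentiableAt_cgrad hηC hηH hz))
      (hne' z (Ioo_subset_Icc_self hz))
  · rw [im_forceDensity, hconst hηC h0 (fun t => (hB t).1) x,
      hconst hζC h0 (fun t => (hB t).2.1) x, hconst hϑC h0 (fun t => (hB t).2.2) x]
    ring
  · have hη := hd hηC h1 x
    have hζx : pdx ζ (x, 1) = -γ * η (x, 1) * pdx η (x, 1) := by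
      have h := hd hζC h1 x
      simp only [hΓ1] at h
      rw [h.unique (((hη.pow 2).const_mul (γ / 2)).const_sub (1 - γ / 2))]
      norm_num
      ring
    refine ((hasDerivAt_surfaceForce γ ε₁ α (η (x, 1))).comp x hη).congr_deriv ?_
    rw [im_forceDensity, hζx, hconst hϑC h1 hΓ3 x]
    have hJ := hne (x, 1) h1
    field_simp
    linear_combination (-pdx η (x, 1)) * hΓ2 x

theorem laminar_limit {γ ε₁ α C d : ℝ} {η ζ ϑ : ℝ × ℝ → ℝ}
    (hη : DifferentiableOn ℝ η strip) (hζ : DifferentiableOn ℝ ζ strip)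
    (hϑ : DifferentiableOn ℝ ϑ strip)
    (hΓ2 : ∀ x : ℝ,
      (pdy ζ (x, 1) + γ * η (x, 1) * pdy η (x, 1)) ^ 2 + ε₁ * (pdy ϑ (x, 1)) ^ 2
        = (1 + ε₁ - 2 * α * (η (x, 1) - 1))
            * ((pdx η (x, 1)) ^ 2 + (pdy η (x, 1)) ^ 2))
    (hcont : ∀ x : ℝ,
      ContinuousOn (fun y : ℝ => (forceDensity ε₁ η ζ ϑ ⟨x, y⟩).re) (Icc 0 1))
    (hC : ∀ x : ℝ, (∫ y in (0 : ℝ)..1, (forceDensity ε₁ η ζ ϑ ⟨x, y⟩).re)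
      + surfaceForce γ ε₁ α (η (x, 1)) = C)
    (hd : 0 < d) {l : Filter ℝ} [l.NeBot]
    (h : ∀ ε > (0 : ℝ), ∀ᶠ x in l, ∀ y ∈ Icc (0 : ℝ) 1, ∀ n : ℕ, n ≤ 1 →
        ‖iteratedFDerivWithin ℝ n (fun q : ℝ × ℝ => η q - d * q.2) strip (x, y)‖ < ε ∧
        ‖iteratedFDerivWithin ℝ n
            (fun q : ℝ × ℝ => ζ q - ((2 - γ) / (2 * d) - γ * d / 2) * (d * q.2))
            strip (x, y)‖ < ε ∧
        ‖iteratedFDerivWithin ℝ n (fun q : ℝ × ℝ => ϑ q - q.2) strip (x, y)‖ < ε) :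
    (1 - γ / 2 + γ / 2 * d ^ 2) ^ 2 + ε₁ = (1 + ε₁ - 2 * α * (d - 1)) * d ^ 2 ∧
    laminarFlowForce γ ε₁ α d = C := by
  set m : ℝ := 1 - γ / 2 - γ / 2 * d ^ 2 with hm
  have hmd : ((2 - γ) / (2 * d) - γ * d / 2) * d = m := by rw [hm]; field_simp
  have hηt := tendsto_cgrad hη (l := l) (m := d) fun ε hε =>
    (h ε hε).mono fun x hx y hy => (hx y hy 1 le_rfl).1
  have hζt := tendsto_cgrad hζ (l := l) (m := m) fun ε hε =>
    (h ε hε).mono fun x hx y hy => by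
      simpa only [← mul_assoc, hmd] using (hx y hy 1 le_rfl).2.1
  have hϑt := tendsto_cgrad hϑ (l := l) (m := 1) fun ε hε =>
    (h ε hε).mono fun x hx y hy => by simpa only [one_mul] using (hx y hy 1 le_rfl).2.2
  have h1 : (1 : ℝ) ∈ Icc (0 : ℝ) 1 := by simp
  have hη1 : Tendsto (fun x => η (x, 1)) l (𝓝 d) := by
    rw [Metric.tendsto_nhds]
    intro ε hε
    filter_upwards [h ε hε] with x hx
    have := (hx 1 h1 0 zero_le_one).1
    rwa [norm_iteratedFDerivWithin_zero, mul_one] at this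
  have htop : Tendsto (fun x : ℝ => (x, (1 : ℝ))) l (l ×ˢ 𝓟 (Icc (0 : ℝ) 1)) :=
    tendsto_id.prodMk (tendsto_principal.2 (Eventually.of_forall fun _ => h1))
  have hre : ∀ {f : ℝ × ℝ → ℝ} {c : ℝ}, Tendsto (fun p : ℝ × ℝ => cgrad f ⟨p.1, p.2⟩)
      (l ×ˢ 𝓟 (Icc (0 : ℝ) 1)) (𝓝 (c : ℂ)) → Tendsto (fun x => pdy f (x, 1)) l (𝓝 c) :=
    fun hf => (continuous_re.tendsto _).comp (hf.comp htop)
  have him : ∀ {f : ℝ × ℝ → ℝ} {c : ℝ}, Tendsto (fun p : ℝ × ℝ => cgrad f ⟨p.1, p.2⟩)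
      (l ×ˢ 𝓟 (Icc (0 : ℝ) 1)) (𝓝 (c : ℂ)) → Tendsto (fun x => pdx f (x, 1)) l (𝓝 0) :=
    fun hf => (continuous_im.tendsto _).comp (hf.comp htop)
  constructor
  · have hL := (((hre hζt).add ((hη1.const_mul γ).mul (hre hηt))).pow 2).add
      (((hre hϑt).pow 2).const_mul ε₁)
    have hR := (((hη1.sub_const 1).const_mul (2 * α)).const_sub (1 + ε₁)).mul
      (((him hηt).pow 2).add ((hre hηt).pow 2))
    have := tendsto_nhds_unique (hL.congr hΓ2) hR
    rw [hm] at this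
    linear_combination this
  · have hg := ((hζt.pow 2).add ((hϑt.pow 2).const_mul (ε₁ : ℂ))).div (hηt.const_mul 2)
      (by simpa using hd.ne')
    have hg' := (continuous_re.tendsto _).comp hg
    have hval : (((m : ℂ) ^ 2 + ε₁ * ((1 : ℝ) : ℂ) ^ 2) / (2 * d)).re
        = (m ^ 2 + ε₁) / (2 * d) := by
      rw [← ofReal_re ((m ^ 2 + ε₁) / (2 * d))]
      push_cast
      ring_nf
    rw [hval] at hg'
    have hS := (tendsto_integral_of_tendsto_prod_principal
      (g := fun p => (forceDensity ε₁ η ζ ϑ ⟨p.1, p.2⟩).re) hg' hcont).add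
      ((hasDerivAt_surfaceForce γ ε₁ α d).continuousAt.tendsto.comp hη1)
    exact tendsto_nhds_unique hS (tendsto_const_nhds.congr fun x => (hC x).symm)

end FlowForce

/-- Nonexistence of bore solutions: a solution `(η, ζ, ϑ)` of the conformally mapped
electrohydrodynamic system on the strip (harmonic in `R`, satisfying the kinematic,
dynamic and potential boundary conditions on `Γ`, vanishing on `B`, and uniformly
non-degenerate) whose profile, together with its first-order partial derivatives,
converges uniformly in `y` as `x → −∞` (resp. `x → +∞`) to the laminar flow of depth
`d₋` (resp. `d₊`) must have `d₋ = d₊`. -/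
theorem stmt_6 (γ ε₁ α : ℝ) (hε₁ : 0 < ε₁) (hα : 0 < α)
    (η ζ ϑ : ℝ × ℝ → ℝ)
    (hηC : ContDiffOn ℝ 2 η strip) (hζC : ContDiffOn ℝ 2 ζ strip)
    (hϑC : ContDiffOn ℝ 2 ϑ strip)
    (hηH : ∀ p ∈ stripO, pdx (pdx η) p + pdy (pdy η) p = 0)
    (hζH : ∀ p ∈ stripO, pdx (pdx ζ) p + pdy (pdy ζ) p = 0)
    (hϑH : ∀ p ∈ stripO, pdx (pdx ϑ) p + pdy (pdy ϑ) p = 0)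
    (hΓ1 : ∀ x : ℝ, ζ (x, 1) = 1 - γ / 2 - (γ / 2) * (η (x, 1)) ^ 2)
    (hΓ2 : ∀ x : ℝ,
      (pdy ζ (x, 1) + γ * η (x, 1) * pdy η (x, 1)) ^ 2 + ε₁ * (pdy ϑ (x, 1)) ^ 2
        = (1 + ε₁ - 2 * α * (η (x, 1) - 1))
            * ((pdx η (x, 1)) ^ 2 + (pdy η (x, 1)) ^ 2))
    (hΓ3 : ∀ x : ℝ, ϑ (x, 1) = 1)
    (hB : ∀ x : ℝ, η (x, 0) = 0 ∧ ζ (x, 0) = 0 ∧ ϑ (x, 0) = 0)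
    (hinf : ∃ δ > 0, ∀ p ∈ strip,
      δ ≤ (1 + ε₁ - 2 * α * (η p - 1)) ^ 2 * ((pdx η p) ^ 2 + (pdy η p) ^ 2))
    (dm dp : ℝ) (hdm : 0 < dm) (hdp : 0 < dp)
    (hminus : ∀ ε > (0 : ℝ), ∃ M : ℝ, ∀ p ∈ strip, p.1 ≤ M →
      ∀ n : ℕ, n ≤ 1 →
        ‖iteratedFDerivWithin ℝ n (fun q : ℝ × ℝ => η q - dm * q.2) strip p‖ < ε ∧
        ‖iteratedFDerivWithin ℝ n
            (fun q : ℝ × ℝ => ζ q - ((2 - γ) / (2 * dm) - γ * dm / 2) * (dm * q.2))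
            strip p‖ < ε ∧
        ‖iteratedFDerivWithin ℝ n (fun q : ℝ × ℝ => ϑ q - q.2) strip p‖ < ε)
    (hplus : ∀ ε > (0 : ℝ), ∃ M : ℝ, ∀ p ∈ strip, M ≤ p.1 →
      ∀ n : ℕ, n ≤ 1 →
        ‖iteratedFDerivWithin ℝ n (fun q : ℝ × ℝ => η q - dp * q.2) strip p‖ < ε ∧
        ‖iteratedFDerivWithin ℝ n
            (fun q : ℝ × ℝ => ζ q - ((2 - γ) / (2 * dp) - γ * dp / 2) * (dp * q.2))
            strip p‖ < ε ∧
        ‖iteratedFDerivWithin ℝ n (fun q : ℝ × ℝ => ϑ q - q.2) strip p‖ < ε) :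
    dm = dp := by
  have hne : ∀ p ∈ strip, pdx η p ^ 2 + pdy η p ^ 2 ≠ 0 := by
    obtain ⟨δ, hδ, h⟩ := hinf
    intro p hp h0
    have := h p hp
    rw [h0, mul_zero] at this
    linarith
  obtain ⟨hcont, hS⟩ := flowForce_eq (ε₁ := ε₁) hηC hζC hϑC hηH hζH hϑH hΓ1 hΓ2 hΓ3 hB hne
  have hη := hηC.differentiableOn two_ne_zero
  have hζ := hζC.differentiableOn two_ne_zero
  have hϑ := hϑC.differentiableOn two_ne_zero
  obtain ⟨hBm, hSm⟩ := laminar_limit hη hζ hϑ hΓ2 hcont (fun x => hS x 0) hdm (l := Filter.atBot)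
    fun ε hε => by
      obtain ⟨M, hM⟩ := hminus ε hε
      filter_upwards [Filter.eventually_le_atBot M] with x hx y hy
      exact hM (x, y) hy hx
  obtain ⟨hBp, hSp⟩ := laminar_limit hη hζ hϑ hΓ2 hcont (fun x => hS x 0) hdp (l := Filter.atTop)
    fun ε hε => by
      obtain ⟨M, hM⟩ := hplus ε hε
      filter_upwards [Filter.eventually_ge_atTop M] with x hx y hy
      exact hM (x, y) hy hx
  exact depth_eq_of_laminarFlowForce_eq hε₁ hdm hdp hBm hBp (hSm.trans hSp.symm)
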